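/- Let U ⊆ ℂ be open, F : U → ℂ holomorphic, A = (A₁, A₂) a real C¹ vector field and ψ a complex C¹ function, both defined on an open set containing F(U). Identify ℂ with ℝ², set Ã(z) = DF(z)ᵀ · A(F(z)) and ψ̃ = ψ ∘ F. Then for every z ∈ U: (−i∇ − Ã)ψ̃ (z) = DF(z)ᵀ · ( ((−i∇ − A)ψ)(F(z)) ), and consequently |(−i∇ − Ã)ψ̃|²(z) = |F′(z)|² · |(−i∇ − A)ψ|²(F(z)), where |(−i∇ − A)ψ|² = |(−i∂₁ − A₁)ψ|² + |(−i∂₂ − A₂)ψ|². -/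

import Mathlib

open MeasureTheory

/-- First component of `(-i∇ - A)ψ` on `ℂ ≅ ℝ²`. -/
noncomputable def mag1 (Aa : ℂ → ℝ) (ψ : ℂ → ℂ) (w : ℂ) : ℂ :=
  -Complex.I * fderiv ℝ ψ w 1 - (Aa w : ℂ) * ψ w

/-- Second component of `(-i∇ - A)ψ` on `ℂ ≅ ℝ²`. -/
noncomputable def mag2 (Aa : ℂ → ℝ) (ψ : ℂ → ℂ) (w : ℂ) : ℂ :=
  -Complex.I * fderiv ℝ ψ w Complex.I - (Aa w : ℂ) * ψ w

/-- A real-linear map on `ℂ` is determined by its values at `1` and `I`. -/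
lemma Complex.clm_apply_eq_re_add_im (L : ℂ →L[ℝ] ℂ) (w : ℂ) :
    L w = (w.re : ℂ) * L 1 + (w.im : ℂ) * L Complex.I := by
  have h : w = w.re • (1 : ℂ) + w.im • Complex.I := by
    simp [Complex.re_add_im]
  conv_lhs => rw [h, map_add, map_smul, map_smul]
  simp only [Complex.real_smul]

/-- Multiplication by `d`, acting on pairs of complex numbers through its real transpose,
scales the sum of squared norms by `‖d‖ ^ 2`. -/
lemma Complex.norm_sq_add_norm_sq_conformal (d a b : ℂ) :
    ‖(d.re : ℂ) * a + (d.im : ℂ) * b‖ ^ 2 + ‖(-d.im : ℂ) * a + (d.re : ℂ) * b‖ ^ 2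
      = ‖d‖ ^ 2 * (‖a‖ ^ 2 + ‖b‖ ^ 2) := by
  simp only [Complex.sq_norm, Complex.normSq_apply, Complex.add_re, Complex.add_im,
    Complex.mul_re, Complex.mul_im, Complex.neg_re, Complex.neg_im, Complex.ofReal_re,
    Complex.ofReal_im]
  ring

/-- Pointwise conformal covariance of the magnetic derivative:
`(-i∇ - Ã)ψ̃ (z) = DF(z)ᵀ ((-i∇-A)ψ)(F z)`, and the resulting identity for the
kinetic energy density. -/
theorem stmt_14 (U W : Set ℂ) (hU : IsOpen U) (hW : IsOpen W)
    (F : ℂ → ℂ) (hF : DifferentiableOn ℂ F U) (hFW : F '' U ⊆ W)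
    (A1 A2 : ℂ → ℝ) (hA1 : ContDiffOn ℝ 1 A1 W) (hA2 : ContDiffOn ℝ 1 A2 W)
    (ψ : ℂ → ℂ) (hψ : ContDiffOn ℝ 1 ψ W)
    (At1 At2 : ℂ → ℝ)
    (hAt1 : ∀ z : ℂ, At1 z
      = (fderiv ℝ F z 1).re * A1 (F z) + (fderiv ℝ F z 1).im * A2 (F z))
    (hAt2 : ∀ z : ℂ, At2 z
      = (fderiv ℝ F z Complex.I).re * A1 (F z) + (fderiv ℝ F z Complex.I).im * A2 (F z)) :
    ∀ z ∈ U,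
      (mag1 At1 (ψ ∘ F) z
        = ((fderiv ℝ F z 1).re : ℂ) * mag1 A1 ψ (F z)
          + ((fderiv ℝ F z 1).im : ℂ) * mag2 A2 ψ (F z)) ∧
      (mag2 At2 (ψ ∘ F) z
        = ((fderiv ℝ F z Complex.I).re : ℂ) * mag1 A1 ψ (F z)
          + ((fderiv ℝ F z Complex.I).im : ℂ) * mag2 A2 ψ (F z)) ∧
      (‖mag1 At1 (ψ ∘ F) z‖ ^ 2 + ‖mag2 At2 (ψ ∘ F) z‖ ^ 2
        = ‖deriv F z‖ ^ 2
          * (‖mag1 A1 ψ (F z)‖ ^ 2 + ‖mag2 A2 ψ (F z)‖ ^ 2)) := by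
  intro z hz
  have hFd : DifferentiableAt ℂ F z := hF.differentiableAt (hU.mem_nhds hz)
  have hψd : DifferentiableAt ℝ ψ (F z) :=
    (hψ.differentiableOn one_ne_zero).differentiableAt
      (hW.mem_nhds (hFW (Set.mem_image_of_mem F hz)))
  have hcomp : ∀ v, fderiv ℝ (ψ ∘ F) z v
      = ((fderiv ℝ F z v).re : ℂ) * fderiv ℝ ψ (F z) 1
        + ((fderiv ℝ F z v).im : ℂ) * fderiv ℝ ψ (F z) Complex.I := by
    intro v
    rw [fderiv_comp z hψd (hFd.restrictScalars ℝ), ContinuousLinearMap.comp_apply,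
      Complex.clm_apply_eq_re_add_im]
  have hone : fderiv ℝ F z 1 = deriv F z := by
    rw [hFd.fderiv_restrictScalars ℝ]
    simp
  have hI : fderiv ℝ F z Complex.I = Complex.I * deriv F z := by
    rw [hFd.fderiv_restrictScalars ℝ]
    simp [fderiv_eq_smul_deriv]
  have h1 : mag1 At1 (ψ ∘ F) z
      = ((fderiv ℝ F z 1).re : ℂ) * mag1 A1 ψ (F z)
        + ((fderiv ℝ F z 1).im : ℂ) * mag2 A2 ψ (F z) := by
    simp only [mag1, mag2, hcomp, hAt1, Function.comp_apply]
    push_cast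
    ring
  have h2 : mag2 At2 (ψ ∘ F) z
      = ((fderiv ℝ F z Complex.I).re : ℂ) * mag1 A1 ψ (F z)
        + ((fderiv ℝ F z Complex.I).im : ℂ) * mag2 A2 ψ (F z) := by
    simp only [mag1, mag2, hcomp, hAt2, Function.comp_apply]
    push_cast
    ring
  refine ⟨h1, h2, ?_⟩
  rw [h1, h2, hone, hI, Complex.I_mul_re, Complex.I_mul_im, Complex.ofReal_neg]
  exact Complex.norm_sq_add_norm_sq_conformal _ _ _
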